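/- arXiv:2505.08079 — 2 statements merged into one kernel-verified Lean document; each statement's English description precedes it below -/
import Mathlib

section
/- Suppose each of A, B, C is coprime to MN. Then the GDAFT preserves inner products: for all x, y : ℤ/(MN)ℤ → ℂ, ⟨F_a x, F_a y⟩ = ⟨x, y⟩. -/
open Finset

/-- e^{2πi t / Q} for an integer `t` and modulus `Q`. -/
noncomputable def eFrac (Q : ℕ) (t : ℤ) : ℂ :=
  Complex.exp (2 * Real.pi * Complex.I * (t : ℂ) / (Q : ℂ))

/-- Generalized discrete affine Fourier transform (GDAFT). -/
noncomputable def gdaft (M N : ℕ) (A B C : ℤ) (x : ZMod (M * N) → ℂ) :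
    ZMod (M * N) → ℂ :=
  fun n => (Real.sqrt (M * N) : ℂ)⁻¹ *
    ∑ m ∈ Finset.range (M * N),
      eFrac (M * N) (A * (n.val : ℤ) ^ 2 + B * (n.val : ℤ) * (m : ℤ) + C * (m : ℤ) ^ 2) *
        x (m : ZMod (M * N))

/-- Inverse GDAFT. -/
noncomputable def igdaft (M N : ℕ) (A B C : ℤ) (x : ZMod (M * N) → ℂ) :
    ZMod (M * N) → ℂ :=
  fun m => (Real.sqrt (M * N) : ℂ)⁻¹ *
    ∑ n ∈ Finset.range (M * N),
      eFrac (M * N) (-(A * (n : ℤ) ^ 2 + B * (n : ℤ) * (m.val : ℤ) + C * (m.val : ℤ) ^ 2)) *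
        x (n : ZMod (M * N))

/-- The pulsone localized at `(k0, l0)`. -/
noncomputable def pulsone (M N : ℕ) (k0 l0 : ℕ) : ZMod (M * N) → ℂ :=
  fun n => if n.val % M = k0 then
    (Real.sqrt N : ℂ)⁻¹ * eFrac N ((n.val / M : ℕ) * l0) else 0

/-- Cross-ambiguity function of two `MN`-periodic sequences. -/
noncomputable def amb (M N : ℕ) (y x : ZMod (M * N) → ℂ) (k l : ZMod (M * N)) : ℂ :=
  ((M * N : ℕ) : ℂ)⁻¹ * ∑ n ∈ Finset.range (M * N),
    y (n : ZMod (M * N)) * (starRingEnd ℂ) (x ((n : ZMod (M * N)) - k)) *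
      eFrac (M * N) (-((l * ((n : ZMod (M * N)) - k)).val : ℤ))

/-- Delay-Doppler shift operator. -/
noncomputable def ddShift (M N : ℕ) (k l : ZMod (M * N)) (x : ZMod (M * N) → ℂ) :
    ZMod (M * N) → ℂ :=
  fun n => x (n - k) * eFrac (M * N) ((l * (n - k)).val : ℤ)

/-- Inner product ⟨x, y⟩ = Σ x[n] conj(y[n]). -/
noncomputable def innerMN (M N : ℕ) (x y : ZMod (M * N) → ℂ) : ℂ :=
  ∑ n ∈ Finset.range (M * N),
    x (n : ZMod (M * N)) * (starRingEnd ℂ) (y (n : ZMod (M * N)))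


/-- A sum over `0, …, Q - 1` of a function on `ZMod Q` is the sum over all residues. -/
theorem sum_range_eq_sum_zmod {R : Type*} [AddCommMonoid R] (Q : ℕ) [NeZero Q] (f : ZMod Q → R) :
    ∑ n ∈ Finset.range Q, f (n : ZMod Q) = ∑ n : ZMod Q, f n := by
  refine Finset.sum_bij' (fun n _ => (n : ZMod Q)) (fun a _ => a.val) ?_ ?_ ?_ ?_ ?_
  · simp
  · intro a _
    exact Finset.mem_range.2 (ZMod.val_lt a)
  · intro n hn
    exact ZMod.val_cast_of_lt (Finset.mem_range.1 hn)
  · simp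
  · simp

theorem eFrac_eq_stdAddChar (Q : ℕ) [NeZero Q] (t : ℤ) :
    eFrac Q t = ZMod.stdAddChar (t : ZMod Q) := by
  rw [ZMod.stdAddChar_coe, eFrac]

theorem innerMN_eq_sum (M N : ℕ) [NeZero (M * N)] (x y : ZMod (M * N) → ℂ) :
    innerMN M N x y = ∑ n, x n * (starRingEnd ℂ) (y n) :=
  sum_range_eq_sum_zmod (M * N) fun n => x n * (starRingEnd ℂ) (y n)

theorem gdaft_eq_sum (M N : ℕ) [NeZero (M * N)] (A B C : ℤ) (x : ZMod (M * N) → ℂ)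
    (n : ZMod (M * N)) :
    gdaft M N A B C x n = (Real.sqrt (M * N) : ℂ)⁻¹ *
      ∑ m, ZMod.stdAddChar (A * n ^ 2 + B * n * m + C * m ^ 2 : ZMod (M * N)) * x m := by
  rw [gdaft, ← sum_range_eq_sum_zmod]
  simp [eFrac_eq_stdAddChar]

/-- Orthogonality of the rows of the GDAFT kernel. -/
theorem sum_gdaft_kernel_mul_conj {Q : ℕ} [NeZero Q] {a b c : ZMod Q} (hb : IsUnit b)
    (m k : ZMod Q) :
    ∑ n : ZMod Q, ZMod.stdAddChar (a * n ^ 2 + b * n * m + c * m ^ 2) *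
      (starRingEnd ℂ) (ZMod.stdAddChar (a * n ^ 2 + b * n * k + c * k ^ 2)) =
      if m = k then (Q : ℂ) else 0 := by
  have key (n : ZMod Q) : ZMod.stdAddChar (a * n ^ 2 + b * n * m + c * m ^ 2) *
      (starRingEnd ℂ) (ZMod.stdAddChar (a * n ^ 2 + b * n * k + c * k ^ 2)) =
      ZMod.stdAddChar (c * (m ^ 2 - k ^ 2)) * ZMod.stdAddChar (n * (b * (m - k))) := by
    rw [← AddChar.map_neg_eq_conj, ← AddChar.map_add_eq_mul, ← AddChar.map_add_eq_mul]
    congr 1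
    ring
  simp_rw [key]
  rw [← Finset.mul_sum, AddChar.sum_mulShift _ (ZMod.isPrimitive_stdAddChar Q)]
  by_cases h : m = k
  · simp [h, ZMod.card]
  · simp [h, hb.mul_right_eq_zero, sub_eq_zero]

/-- **GDAFT preserves inner products.** If `A`, `B`, `C` are each coprime to `M*N`, then
`⟨F_a x, F_a y⟩ = ⟨x, y⟩` for all sequences `x`, `y`. -/
theorem gdaft_preserves_inner (M N : ℕ) (hM : 0 < M) (hN : 0 < N) (A B C : ℤ)
    (hA : IsCoprime A ((M * N : ℕ) : ℤ)) (hB : IsCoprime B ((M * N : ℕ) : ℤ))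
    (hC : IsCoprime C ((M * N : ℕ) : ℤ)) :
    ∀ x y : ZMod (M * N) → ℂ,
      innerMN M N (gdaft M N A B C x) (gdaft M N A B C y) = innerMN M N x y := by
  intro x y
  have : NeZero (M * N) := ⟨(Nat.mul_pos hM hN).ne'⟩
  have hQ : ((M * N : ℕ) : ℂ) ≠ 0 := Nat.cast_ne_zero.2 (NeZero.ne _)
  have hB' : IsUnit (B : ZMod (M * N)) :=
    (ZMod.coe_int_isUnit_iff_isCoprime B (M * N)).2 hB.symm
  have hs : (Real.sqrt (M * N) : ℂ)⁻¹ * (Real.sqrt (M * N) : ℂ)⁻¹ = ((M * N : ℕ) : ℂ)⁻¹ := by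
    rw [← mul_inv, ← Complex.ofReal_mul, Real.mul_self_sqrt (by positivity)]
    push_cast
    rfl
  simp only [innerMN_eq_sum, gdaft_eq_sum, map_mul, map_inv₀, Complex.conj_ofReal, map_sum]
  calc
    _ = ((M * N : ℕ) : ℂ)⁻¹ *
          ∑ m : ZMod (M * N), ∑ k : ZMod (M * N), x m * (starRingEnd ℂ) (y k) *
            ∑ n : ZMod (M * N),
              ZMod.stdAddChar (A * n ^ 2 + B * n * m + C * m ^ 2 : ZMod (M * N)) *
                (starRingEnd ℂ)
                  (ZMod.stdAddChar (A * n ^ 2 + B * n * k + C * k ^ 2 : ZMod (M * N))) := by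
      simp_rw [mul_mul_mul_comm _ _ (_⁻¹ : ℂ), hs, ← Finset.mul_sum, Finset.sum_mul_sum]
      rw [Finset.sum_comm]
      congr 1
      refine Finset.sum_congr rfl fun m _ => ?_
      rw [Finset.sum_comm]
      refine Finset.sum_congr rfl fun k _ => ?_
      rw [Finset.mul_sum]
      exact Finset.sum_congr rfl fun n _ => by ring
    _ = _ := by
      simp_rw [sum_gdaft_kernel_mul_conj hB']
      simp only [mul_ite, mul_zero, Finset.sum_ite_eq, Finset.mem_univ, if_true]
      rw [← Finset.sum_mul, mul_comm, mul_assoc, mul_inv_cancel₀ hQ, mul_one]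
end

section
/- Let N be an odd positive integer and let a, b be integers with gcd(a, N) = 1. Then the quadratic Gauss sum evaluates as Σ_{n=0}^{N−1} e^{(2πi/N)(a n² + b n)} = ε_N · √N · J(a, N) · e^{−(2πi/N)·((4a)⁻¹ mod N)·b²}, where ε_N = 1 if N ≡ 1 (mod 4) and ε_N = i if N ≡ 3 (mod 4), J(a, N) is the Jacobi symbol of a over N, and (4a)⁻¹ mod N denotes the multiplicative inverse of 4a modulo N. -/
open Finset in
theorem Finset.sum_range_mul_eq_sum_sum {M : Type*} [AddCommMonoid M] (f : ℕ → M) (m k : ℕ) :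
    ∑ n ∈ range (m * k), f n = ∑ x ∈ range m, ∑ y ∈ range k, f (x + m * y) := by
  induction k with
  | zero => simp
  | succ k ih =>
    rw [Nat.mul_succ, sum_range_add, ih]
    simp only [sum_range_succ, sum_add_distrib, add_comm]

theorem ZMod.sum_range_natCast {M : Type*} [AddCommMonoid M] (N : ℕ) [NeZero N] (f : ZMod N → M) :
    ∑ n ∈ Finset.range N, f (n : ZMod N) = ∑ x, f x := by
  refine Finset.sum_nbij' (fun n ↦ (n : ZMod N)) ZMod.val ?_ ?_ ?_ ?_ ?_
  · simp
  · simp [ZMod.val_lt]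
  · intro n hn
    exact ZMod.val_cast_of_lt (Finset.mem_range.1 hn)
  · simp
  · simp

theorem ZMod.isUnit_two_of_odd {N : ℕ} (hN : Odd N) : IsUnit (2 : ZMod N) := by
  have := (ZMod.isUnit_iff_coprime 2 N).2 (Nat.coprime_two_left.2 hN)
  simpa using this

/-- Multiplying numerator and denominator of the argument by `k` does not change `e(z / N)`. -/
theorem ZMod.stdAddChar_mul_right (N k : ℕ) [NeZero N] [NeZero k] (z : ℤ) :
    ZMod.stdAddChar ((k * z : ℤ) : ZMod (N * k)) = ZMod.stdAddChar (z : ZMod N) := by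
  rw [ZMod.stdAddChar_coe, ZMod.stdAddChar_coe]
  congr 1
  have hN : (N : ℂ) ≠ 0 := NeZero.ne _
  have hk : (k : ℂ) ≠ 0 := NeZero.ne _
  push_cast
  field_simp

/-- The pure quadratic Gauss sum `∑ x, e(a x² / N)`. -/
noncomputable def quadGaussSum (a : ℤ) (N : ℕ) [NeZero N] : ℂ :=
  ∑ x : ZMod N, ZMod.stdAddChar ((a : ZMod N) * x ^ 2)

theorem quadGaussSum_eq_sum_range (a : ℤ) (N : ℕ) [NeZero N] :
    quadGaussSum a N = ∑ n ∈ Finset.range N, ZMod.stdAddChar ((a * n ^ 2 : ℤ) : ZMod N) := by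
  rw [quadGaussSum, ← ZMod.sum_range_natCast]
  simp

theorem quadGaussSum_one_mul_conj {N : ℕ} [NeZero N] (hN : Odd N) :
    quadGaussSum 1 N * starRingEnd ℂ (quadGaussSum 1 N) = N := by
  classical
  have h2 := ZMod.isUnit_two_of_odd hN
  calc
    _ = ∑ y : ZMod N, ∑ x : ZMod N, ZMod.stdAddChar (x ^ 2 - y ^ 2) := by
      rw [quadGaussSum, map_sum, Finset.sum_mul_sum, Finset.sum_comm]
      simp [sub_eq_add_neg, AddChar.map_add_eq_mul, AddChar.map_neg_eq_conj]
    _ = ∑ y : ZMod N, ∑ d : ZMod N, ZMod.stdAddChar ((d + y) ^ 2 - y ^ 2) := by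
      refine Finset.sum_congr rfl fun y _ ↦ ?_
      exact (Fintype.sum_equiv (Equiv.addRight y) _ _ fun _ ↦ rfl).symm
    _ = ∑ d : ZMod N, ZMod.stdAddChar (d ^ 2) * ∑ y : ZMod N, ZMod.stdAddChar (y * (2 * d)) := by
      rw [Finset.sum_comm]
      simp_rw [Finset.mul_sum, ← AddChar.map_add_eq_mul]
      refine Finset.sum_congr rfl fun d _ ↦ Finset.sum_congr rfl fun y _ ↦ ?_
      congr 1
      ring
    _ = N := by
      simp [AddChar.sum_mulShift _ (ZMod.isPrimitive_stdAddChar N), h2.mul_right_eq_zero]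

theorem quadGaussSum_mul (a : ℤ) {m n : ℕ} [NeZero m] [NeZero n] {s t : ℤ}
    (h : s * n + t * m = 1) :
    quadGaussSum a (m * n) = quadGaussSum (a * s) m * quadGaussSum (a * t) n := by
  have hmn : m.Coprime n := by
    rw [← Nat.isCoprime_iff_coprime]
    exact ⟨t, s, by linarith⟩
  rw [quadGaussSum, quadGaussSum, quadGaussSum, Finset.sum_mul_sum, ← Fintype.sum_prod_type',
    ← (ZMod.chineseRemainder hmn).toEquiv.sum_comp]
  refine Finset.sum_congr rfl fun x _ ↦ ?_
  obtain ⟨k, rfl⟩ := ZMod.intCast_surjective x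
  have h1 : (ZMod.chineseRemainder hmn).toEquiv (k : ZMod (m * n)) = ((k : ZMod m), (k : ZMod n)) :=
    map_intCast (ZMod.chineseRemainder hmn) k
  rw [h1]
  have e1 := ZMod.stdAddChar_mul_right m n (a * s * k ^ 2)
  have e2 : ZMod.stdAddChar ((m * (a * t * k ^ 2) : ℤ) : ZMod (m * n)) =
      ZMod.stdAddChar ((a * t * k ^ 2 : ℤ) : ZMod n) := by
    have := ZMod.stdAddChar_mul_right n m (a * t * k ^ 2)
    rw [ZMod.stdAddChar_coe] at this ⊢
    rw [← this]
    congr 1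
    push_cast
    ring
  simp only [← Int.cast_pow, ← Int.cast_mul]
  rw [← e1, ← e2, ← AddChar.map_add_eq_mul, ← Int.cast_add]
  congr 2
  linear_combination (-a * k ^ 2) * h

theorem quadGaussSum_mul_sq (a : ℤ) {p m : ℕ} [NeZero m] [Fact p.Prime] [NeZero (p * m * p)]
    (hp : p ≠ 2) (ha : ¬ (p : ℤ) ∣ a) :
    quadGaussSum a (p * m * p) = p * quadGaussSum a m := by
  have hpp := (Fact.out : p.Prime)
  have ha' : (a : ZMod p) ≠ 0 := by rwa [Ne, ZMod.intCast_zmod_eq_zero_iff_dvd]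
  have h2 : (2 : ZMod p) ≠ 0 := (ZMod.isUnit_two_of_odd (hpp.odd_of_ne_two hp)).ne_zero
  have : NeZero (p * m) := ⟨mul_ne_zero hpp.ne_zero (NeZero.ne m)⟩
  have key (x y : ℕ) : ZMod.stdAddChar ((a * (x + p * m * y : ℕ) ^ 2 : ℤ) : ZMod (p * m * p)) =
      ZMod.stdAddChar ((a * x ^ 2 : ℤ) : ZMod (p * m * p)) *
        ZMod.stdAddChar ((y : ZMod p) * (2 * (a : ZMod p) * (x : ZMod p))) := by
    have e : ZMod.stdAddChar ((p * m * (2 * a * x * y) : ℤ) : ZMod (p * m * p)) =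
        ZMod.stdAddChar ((2 * a * x * y : ℤ) : ZMod p) := by
      have := ZMod.stdAddChar_mul_right p (p * m) (2 * a * x * y)
      rw [ZMod.stdAddChar_coe] at this ⊢
      rw [← this]
      congr 1
      push_cast
      ring
    have e' : (y : ZMod p) * (2 * a * x) = ((2 * a * x * y : ℤ) : ZMod p) := by
      push_cast; ring
    rw [e', ← e, ← AddChar.map_add_eq_mul, ← Int.cast_add]
    congr 1
    rw [← sub_eq_zero, ← Int.cast_sub, ZMod.intCast_zmod_eq_zero_iff_dvd]
    refine ⟨a * m * y ^ 2, ?_⟩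
    push_cast
    ring
  have inner (x : ℕ) : ∑ y ∈ Finset.range p,
      ZMod.stdAddChar ((y : ZMod p) * (2 * (a : ZMod p) * (x : ZMod p))) =
      if (x : ZMod p) = 0 then (p : ℂ) else 0 := by
    rw [ZMod.sum_range_natCast p fun y ↦ ZMod.stdAddChar (y * (2 * (a : ZMod p) * (x : ZMod p))),
      AddChar.sum_mulShift _ (ZMod.isPrimitive_stdAddChar p)]
    simp [ha', h2]
  rw [quadGaussSum_eq_sum_range, Finset.sum_range_mul_eq_sum_sum]
  simp_rw [key, ← Finset.mul_sum, inner]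
  rw [Finset.sum_range_mul_eq_sum_sum, Finset.sum_eq_single_of_mem 0 (by simp [hpp.pos]),
    quadGaussSum_eq_sum_range, Finset.mul_sum]
  · refine Finset.sum_congr rfl fun j _ ↦ ?_
    have e : ZMod.stdAddChar ((a * (0 + p * j : ℕ) ^ 2 : ℤ) : ZMod (p * m * p)) =
        ZMod.stdAddChar ((a * j ^ 2 : ℤ) : ZMod m) := by
      have : NeZero (p * p) := ⟨mul_ne_zero hpp.ne_zero hpp.ne_zero⟩
      have := ZMod.stdAddChar_mul_right m (p * p) (a * j ^ 2)
      rw [ZMod.stdAddChar_coe] at this ⊢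
      rw [← this]
      congr 1
      push_cast
      ring
    rw [e]
    simp [mul_comm]
  · intro i hi hi0
    refine Finset.sum_eq_zero fun j _ ↦ ?_
    have : ((i + p * j : ℕ) : ZMod p) ≠ 0 := by
      rw [Ne, ZMod.natCast_eq_zero_iff, Nat.dvd_add_left (dvd_mul_right p j)]
      exact fun h ↦ hi0 (Nat.eq_zero_of_dvd_of_lt h (Finset.mem_range.1 hi))
    rw [if_neg this, mul_zero]

theorem quadGaussSum_prime (a : ℤ) {p : ℕ} [Fact p.Prime] (hp : p ≠ 2) (ha : ¬ (p : ℤ) ∣ a) :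
    quadGaussSum a p = legendreSym p a * quadGaussSum 1 p := by
  classical
  have ha' : (a : ZMod p) ≠ 0 := by rwa [Ne, ZMod.intCast_zmod_eq_zero_iff_dvd]
  let χ : MulChar (ZMod p) ℂ := (quadraticChar (ZMod p)).ringHomComp (Int.castRingHom ℂ)
  have key (c : ℤ) (hc : (c : ZMod p) ≠ 0) :
      quadGaussSum c p = gaussSum χ (ZMod.stdAddChar.mulShift (c : ZMod p)) := by
    have h0 : ∑ y : ZMod p, ZMod.stdAddChar ((c : ZMod p) * y) = 0 := by
      simp_rw [mul_comm (c : ZMod p), AddChar.sum_mulShift _ (ZMod.isPrimitive_stdAddChar p)]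
      simp [hc]
    rw [quadGaussSum, gaussSum, ← Finset.sum_fiberwise Finset.univ fun x : ZMod p ↦ x ^ 2,
      ← add_zero (∑ y : ZMod p, χ y * _), ← h0, ← Finset.sum_add_distrib]
    refine Finset.sum_congr rfl fun y _ ↦ ?_
    have hcard := quadraticChar_card_sqrts ((ZMod.ringChar_zmod_n p).substr hp) y
    have hcard' : ((Finset.univ.filter fun x : ZMod p ↦ x ^ 2 = y).card : ℂ) = χ y + 1 := by
      have : (Finset.univ.filter fun x : ZMod p ↦ x ^ 2 = y) =
        {x : ZMod p | x ^ 2 = y}.toFinset := by ext; simp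
      rw [this]
      have := congrArg (Int.cast : ℤ → ℂ) hcard
      simpa [χ] using this
    rw [Finset.sum_congr rfl (g := fun _ ↦ ZMod.stdAddChar ((c : ZMod p) * y)),
      Finset.sum_const, nsmul_eq_mul, hcard', AddChar.mulShift_apply]
    · ring
    · intro x hx
      rw [(Finset.mem_filter.1 hx).2]
  have hs := gaussSum_mulShift χ ZMod.stdAddChar (Units.mk0 (a : ZMod p) ha')
  rw [Units.val_mk0, ← key a ha'] at hs
  have h1 := key 1 (by simp)
  rw [Int.cast_one, AddChar.mulShift_one] at h1
  have hχ : χ (a : ZMod p) = legendreSym p a := by simp [χ, legendreSym]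
  have hsq : (legendreSym p a : ℂ) ^ 2 = 1 := mod_cast legendreSym.sq_one p ha'
  rw [h1, ← hs, hχ]
  linear_combination (-quadGaussSum a p) * hsq

theorem quadGaussSum_eq_jacobiSym_mul (N : ℕ) [hN0 : NeZero N] (hN : Odd N) (a : ℤ)
    (ha : IsCoprime a (N : ℤ)) :
    quadGaussSum a N = jacobiSym a N * quadGaussSum 1 N := by
  induction N using Nat.strong_induction_on generalizing a hN0 with
  | _ N ih =>
  rcases eq_or_ne N 1 with rfl | hN1
  · simp [quadGaussSum, Subsingleton.elim _ (0 : ZMod 1)]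
  obtain ⟨p, hpp, m, rfl⟩ := Nat.exists_prime_and_dvd hN1
  have : Fact p.Prime := ⟨hpp⟩
  have hm0 : m ≠ 0 := right_ne_zero_of_mul (NeZero.ne (p * m))
  have hp2 : p ≠ 2 := by
    rintro rfl
    exact absurd (Nat.odd_mul.1 hN).1 (by decide)
  have hpdvd {c : ℤ} (hc : IsCoprime c (p : ℤ)) : ¬ (p : ℤ) ∣ c := fun h ↦
    (Nat.prime_iff_prime_int.1 hpp).not_isUnit (hc.symm.isUnit_of_dvd' dvd_rfl h)
  push_cast at ha
  have hap := ha.of_mul_right_left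
  have ham := ha.of_mul_right_right
  by_cases hpm : p ∣ m
  · obtain ⟨k, rfl⟩ := hpm
    have : NeZero k := ⟨right_ne_zero_of_mul hm0⟩
    have hk : Odd k := (Nat.odd_mul.1 (Nat.odd_mul.1 hN).2).2
    have hlt : k < p * (p * k) :=
      (lt_mul_of_one_lt_left (Nat.pos_of_ne_zero (NeZero.ne k)) hpp.one_lt).trans_le
        (Nat.le_mul_of_pos_left _ hpp.pos)
    push_cast at ham
    have h := ih k hlt hk a ham.of_mul_right_right
    have e : p * (p * k) = p * k * p := by ring
    have : NeZero (p * k * p) := by rw [← e]; infer_instance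
    have h1 : ¬ (p : ℤ) ∣ 1 := hpdvd isCoprime_one_left
    have hsq : (jacobiSym a p : ℂ) ^ 2 = 1 :=
      mod_cast jacobiSym.sq_one (Int.isCoprime_iff_gcd_eq_one.1 hap)
    have hj : (jacobiSym a (p * (p * k)) : ℂ) = jacobiSym a k := by
      have : NeZero (p * k) := ⟨hm0⟩
      rw [jacobiSym.mul_right, jacobiSym.mul_right]
      push_cast
      linear_combination (jacobiSym a k : ℂ) * hsq
    have hq (c : ℤ) (hc : ¬ (p : ℤ) ∣ c) :
        quadGaussSum c (p * (p * k)) = p * quadGaussSum c k := by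
      rw [← quadGaussSum_mul_sq c hp2 hc]
      congr 1
    rw [hj, hq a (hpdvd hap), hq 1 h1, h]
    ring
  · have : NeZero m := ⟨hm0⟩
    have hm : Odd m := (Nat.odd_mul.1 hN).2
    have hcop : IsCoprime (m : ℤ) (p : ℤ) :=
      (Nat.isCoprime_iff_coprime.2 ((Nat.Prime.coprime_iff_not_dvd hpp).2 hpm)).symm
    obtain ⟨s, t, h⟩ := hcop
    have hs : IsCoprime s (p : ℤ) := ⟨m, t, by linarith⟩
    have ht : IsCoprime t (m : ℤ) := ⟨p, s, by linarith⟩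
    have hlt : m < p * m := by nlinarith [hpp.two_le, Nat.pos_of_ne_zero hm0]
    rw [quadGaussSum_mul a h, quadGaussSum_mul 1 h, ih m hlt hm _ (ham.mul_left ht),
      ih m hlt hm (1 * t) (by simpa using ht), quadGaussSum_prime _ hp2 (hpdvd (hap.mul_left hs)),
      quadGaussSum_prime (1 * s) hp2 (hpdvd (by simpa using hs)), jacobiSym.mul_right,
      jacobiSym.legendreSym.to_jacobiSym, jacobiSym.legendreSym.to_jacobiSym,
      jacobiSym.mul_left, jacobiSym.mul_left,
      one_mul, one_mul]
    push_cast
    ring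

section

open Finset

/-- The Gaussian binomial coefficient `[n choose k]_q`, as a product of quotients. -/
def gaussBinom {K : Type*} [Field K] (q : K) (n k : ℕ) : K :=
  ∏ i ∈ range k, (1 - q ^ (n - i)) / (1 - q ^ (i + 1))

section gaussBinom

variable {K : Type*} [Field K] {q : K} {n k : ℕ}

theorem gaussBinom_zero_right : gaussBinom q n 0 = 1 := by simp [gaussBinom]

theorem gaussBinom_succ_self : gaussBinom q n (n + 1) = 0 :=
  prod_eq_zero (self_mem_range_succ n) (by simp)

theorem gaussBinom_succ_right :
    gaussBinom q n (k + 1) = gaussBinom q n k * ((1 - q ^ (n - k)) / (1 - q ^ (k + 1))) :=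
  prod_range_succ _ _

theorem one_sub_pow_mul_gaussBinom_succ_succ (hk : 1 - q ^ (k + 1) ≠ 0) :
    (1 - q ^ (k + 1)) * gaussBinom q (n + 1) (k + 1) = (1 - q ^ (n + 1)) * gaussBinom q n k := by
  rw [gaussBinom, gaussBinom, prod_div_distrib, prod_div_distrib, prod_range_succ',
    prod_range_succ (fun i ↦ 1 - q ^ (i + 1))]
  simp only [Nat.add_sub_add_right, Nat.sub_zero]
  field_simp

theorem gaussBinom_succ_succ (hkn : k ≤ n) (hk : 1 - q ^ (k + 1) ≠ 0) :
    gaussBinom q (n + 1) (k + 1) = gaussBinom q n k + q ^ (k + 1) * gaussBinom q n (k + 1) := by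
  apply mul_left_cancel₀ hk
  rw [one_sub_pow_mul_gaussBinom_succ_succ hk, gaussBinom_succ_right]
  have : q ^ (n + 1) = q ^ (k + 1) * q ^ (n - k) := by rw [← pow_add]; congr 1; omega
  rw [this]
  field_simp
  ring

theorem alternating_sum_gaussBinom_add_two (hq : ∀ k ≤ n + 1, 1 - q ^ (k + 1) ≠ 0) :
    ∑ k ∈ range (n + 3), (-1) ^ k * gaussBinom q (n + 2) k =
      (1 - q ^ (n + 1)) * ∑ k ∈ range (n + 1), (-1) ^ k * gaussBinom q n k := by
  have h1 : ∑ k ∈ range (n + 2), (-1) ^ (k + 1) * gaussBinom q (n + 2) (k + 1) =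
      - ∑ k ∈ range (n + 2), (-1) ^ k * gaussBinom q (n + 1) k +
        ∑ k ∈ range (n + 2), (-1) ^ (k + 1) * (q ^ (k + 1) * gaussBinom q (n + 1) (k + 1)) := by
    rw [← sum_neg_distrib, ← sum_add_distrib]
    refine sum_congr rfl fun k hk ↦ ?_
    have := mem_range.1 hk
    rw [gaussBinom_succ_succ (by omega) (hq k (by omega))]
    ring
  rw [sum_range_succ', h1, sum_range_succ' (n := n + 1), sum_range_succ (n := n + 1),
    gaussBinom_succ_self, gaussBinom_zero_right, gaussBinom_zero_right]
  have h2 : ∑ k ∈ range (n + 1), ((-1) ^ (k + 1) * (q ^ (k + 1) * gaussBinom q (n + 1) (k + 1)) -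
      (-1) ^ (k + 1) * gaussBinom q (n + 1) (k + 1)) =
        (1 - q ^ (n + 1)) * ∑ k ∈ range (n + 1), (-1) ^ k * gaussBinom q n k := by
    rw [mul_sum]
    refine sum_congr rfl fun k hk ↦ ?_
    have := mem_range.1 hk
    have := one_sub_pow_mul_gaussBinom_succ_succ (n := n) (hq k (by omega))
    linear_combination (-1) ^ k * this
  rw [← h2, sum_sub_distrib]
  ring

/-- **Gauss's identity** for the alternating sum of Gaussian binomial coefficients. -/
theorem alternating_sum_gaussBinom (m : ℕ) (hq : ∀ k < 2 * m, 1 - q ^ (k + 1) ≠ 0) :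
    ∑ k ∈ range (2 * m + 1), (-1) ^ k * gaussBinom q (2 * m) k =
      ∏ k ∈ range m, (1 - q ^ (2 * k + 1)) := by
  induction m with
  | zero => simp [gaussBinom]
  | succ m ih =>
    rw [prod_range_succ, ← ih fun k hk ↦ hq k (by omega), mul_comm (∑ _ ∈ _, _)]
    exact alternating_sum_gaussBinom_add_two (n := 2 * m) fun k hk ↦ hq k (by omega)

end gaussBinom

/-- For a root of unity `r` of odd order `2 * m + 1`, the sum of `r ^ (k * (k + 1))` as a
product. -/
theorem IsPrimitiveRoot.sum_pow_mul_succ {K : Type*} [Field K] {r : K} {m : ℕ}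
    (hr : IsPrimitiveRoot r (2 * m + 1)) :
    ∑ k ∈ range (2 * m + 1), r ^ (k * (k + 1)) =
      ∏ k ∈ range m, (1 - (r⁻¹) ^ (2 * (2 * k + 1))) := by
  have hr0 : r ≠ 0 := hr.ne_zero (by omega)
  have hq : IsPrimitiveRoot (r⁻¹ ^ 2) (2 * m + 1) :=
    hr.inv.pow_of_coprime 2 (by simp)
  have hq1 (k : ℕ) (hk : k < 2 * m) : 1 - (r⁻¹ ^ 2) ^ (k + 1) ≠ 0 :=
    sub_ne_zero.2 (hq.pow_ne_one_of_pos_of_lt (by omega) (by omega)).symm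
  simp_rw [pow_mul r⁻¹ 2]
  rw [← alternating_sum_gaussBinom m hq1]
  refine sum_congr rfl fun k hk ↦ ?_
  replace hk := mem_range.1 hk
  induction k with
  | zero => simp [gaussBinom]
  | succ k ih =>
    have h1 := hq1 k (by omega)
    have e : (r⁻¹ ^ 2) ^ (2 * m - k) = (r ^ 2) ^ (k + 1) := by
      have : (r⁻¹ ^ 2) ^ (2 * m - k) * (r⁻¹ ^ 2) ^ (k + 1) = 1 := by
        rw [← pow_add, show 2 * m - k + (k + 1) = 2 * m + 1 by omega, hq.pow_eq_one]
      rw [eq_inv_of_mul_eq_one_left this]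
      simp
    have e2 : (1 - (r ^ 2) ^ (k + 1)) / (1 - (r⁻¹ ^ 2) ^ (k + 1)) = - (r ^ 2) ^ (k + 1) := by
      rw [div_eq_iff h1, inv_pow, inv_pow]
      field_simp
      ring
    rw [gaussBinom_succ_right, e, e2, pow_succ (-1 : K)]
    rw [show (k + 1) * (k + 1 + 1) = k * (k + 1) + 2 * (k + 1) by ring, pow_add r, ih (by omega)]
    rw [pow_mul r]
    ring

theorem quadGaussSum_one_eq_prod_sin {N m : ℕ} [NeZero N] (hN : N = 2 * m + 1) :
    quadGaussSum 1 N =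
      ∏ k ∈ range m, (2 * Real.sin (2 * Real.pi * (2 * k + 1) / (2 * m + 1)) * Complex.I) := by
  set r : ℂ := ZMod.stdAddChar (1 : ZMod N) with hr_def
  have hr_exp : r = Complex.exp (2 * Real.pi * Complex.I / N) := by
    have := ZMod.stdAddChar_coe (N := N) 1
    simpa using this
  have hr : IsPrimitiveRoot r N := by
    rw [hr_exp]
    exact Complex.isPrimitiveRoot_exp _ (by omega)
  have hr0 : r ≠ 0 := hr.ne_zero (by omega)
  have hψ (n : ℕ) : ZMod.stdAddChar (n : ZMod N) = r ^ n := by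
    rw [hr_def, ← AddChar.map_nsmul_eq_pow, nsmul_one]
  have hcard : (2 * m + 1 : ZMod N) = 0 := by
    have := congrArg (Nat.cast : ℕ → ZMod N) hN
    rw [ZMod.natCast_self] at this
    simpa using this.symm
  have hodd : r ^ m ^ 2 = ∏ k ∈ range m, r ^ (2 * k + 1) := by
    rw [prod_pow_eq_pow_sum]
    congr 1
    clear_value r
    clear * -
    induction m with
    | zero => simp
    | succ m ih =>
      rw [sum_range_succ, ← ih]
      ring
  calc
    _ = ∑ x : ZMod N, ZMod.stdAddChar ((x - (m : ZMod N)) ^ 2) := by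
      simp only [quadGaussSum, Int.cast_one, one_mul]
      exact (Fintype.sum_equiv (Equiv.subRight (m : ZMod N)) _ _ fun _ ↦ rfl).symm
    _ = ∑ k ∈ range N, r ^ m ^ 2 * r ^ (k * (k + 1)) := by
      rw [← ZMod.sum_range_natCast]
      refine sum_congr rfl fun k _ ↦ ?_
      rw [← pow_add, ← hψ]
      congr 1
      push_cast
      linear_combination (-k : ZMod N) * hcard
    _ = ∏ k ∈ range m, r ^ (2 * k + 1) * (1 - r⁻¹ ^ (2 * (2 * k + 1))) := by
      have hsum := IsPrimitiveRoot.sum_pow_mul_succ (hN ▸ hr)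
      rw [← mul_sum, hN, hsum, prod_mul_distrib, hodd]
    _ = _ := by
      refine prod_congr rfl fun k _ ↦ ?_
      have h1 : r ^ (2 * k + 1) * (1 - r⁻¹ ^ (2 * (2 * k + 1))) =
          r ^ (2 * k + 1) - r⁻¹ ^ (2 * k + 1) := by
        rw [mul_comm 2 (2 * k + 1), pow_mul, inv_pow]
        field_simp
      rw [h1, hr_exp, ← Complex.exp_neg, ← Complex.exp_nat_mul, ← Complex.exp_nat_mul,
        Complex.ofReal_sin, Complex.two_sin]
      have e1 : ((2 * k + 1 : ℕ) : ℂ) * (2 * Real.pi * Complex.I / N) =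
          ((2 * Real.pi * (2 * k + 1) / (2 * m + 1) : ℝ) : ℂ) * Complex.I := by
        rw [hN]
        push_cast
        ring
      rw [mul_neg, e1, ← neg_mul, mul_assoc _ Complex.I Complex.I, Complex.I_mul_I]
      ring

theorem exists_prod_sin_eq (m : ℕ) : ∃ c : ℝ, 0 < c ∧
    ∏ k ∈ range m, (2 * Real.sin (2 * Real.pi * (2 * k + 1) / (2 * m + 1)) * Complex.I) =
      (if Even m then 1 else Complex.I) * c := by
  have hm : (0 : ℝ) < 2 * m + 1 := by positivity
  set s : ℕ → ℝ := fun k ↦ 2 * Real.sin (2 * Real.pi * (2 * k + 1) / (2 * m + 1)) with hs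
  have hpos (k : ℕ) (hk : 2 * k + 1 ≤ m) : 0 < s k := by
    have hk' : (2 * k + 1 : ℝ) ≤ m := mod_cast hk
    refine mul_pos two_pos (Real.sin_pos_of_pos_of_lt_pi (by positivity) ?_)
    rw [div_lt_iff₀ hm]
    nlinarith [Real.pi_pos]
  have hneg (k : ℕ) (hk : m < 2 * k + 1) (hkm : k < m) : 0 < -s k := by
    have hk' : (m + 1 : ℝ) ≤ 2 * k + 1 := mod_cast hk
    have hkm' : (k + 1 : ℝ) ≤ m := mod_cast hkm
    have : 0 < -Real.sin (2 * Real.pi * (2 * k + 1) / (2 * m + 1)) := by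
      rw [← Real.sin_sub_pi]
      refine Real.sin_pos_of_pos_of_lt_pi ?_ ?_
      · rw [sub_pos, lt_div_iff₀ hm]
        nlinarith [Real.pi_pos]
      · rw [sub_lt_iff_lt_add, div_lt_iff₀ hm]
        nlinarith [Real.pi_pos]
    simp only [hs]
    linarith
  refine ⟨(∏ k ∈ range (m - m / 2), s k) * ∏ j ∈ range (m / 2), -s (m - m / 2 + j),
    mul_pos (prod_pos fun k hk ↦ hpos k ?_) (prod_pos fun j hj ↦ hneg _ ?_ ?_), ?_⟩
  · have := mem_range.1 hk
    omega
  · omega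
  · have := mem_range.1 hj
    omega
  · have h1 : ∏ k ∈ range m, s k = (-1) ^ (m / 2) *
        ((∏ k ∈ range (m - m / 2), s k) * ∏ j ∈ range (m / 2), -s (m - m / 2 + j)) := by
      conv_lhs => rw [← Nat.sub_add_cancel (Nat.div_le_self m 2), prod_range_add]
      rw [prod_neg, card_range, mul_left_comm, ← mul_assoc ((-1 : ℝ) ^ (m / 2)), ← mul_pow]
      simp
    have h2 : Complex.I ^ m * (-1) ^ (m / 2) = if Even m then 1 else Complex.I := by
      rcases Nat.even_or_odd' m with ⟨t, rfl | rfl⟩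
      · simp [pow_mul, ← mul_pow]
      · have : (2 * t + 1) / 2 = t := by omega
        rw [this, pow_succ, pow_mul, Complex.I_sq, mul_right_comm, ← mul_pow]
        simp
    have h3 : ∏ k ∈ range m,
        (2 * Real.sin (2 * Real.pi * (2 * k + 1) / (2 * m + 1)) * Complex.I) =
          ((∏ k ∈ range m, s k : ℝ) : ℂ) * Complex.I ^ m := by
      rw [prod_mul_distrib, prod_const, card_range]
      simp [hs]
    rw [h3, h1, ← h2]
    push_cast
    ring

theorem quadGaussSum_one {N : ℕ} [NeZero N] (hN : Odd N) :
    quadGaussSum 1 N = (if N % 4 = 1 then 1 else Complex.I) * (Real.sqrt N : ℂ) := by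
  obtain ⟨m, rfl⟩ := hN
  obtain ⟨c, hc, h⟩ := exists_prod_sin_eq m
  rw [← quadGaussSum_one_eq_prod_sin rfl] at h
  have hnorm := quadGaussSum_one_mul_conj (N := 2 * m + 1) ⟨m, rfl⟩
  have hcsq : c ^ 2 = (2 * m + 1 : ℕ) := by
    rw [h] at hnorm
    have : (c : ℂ) * c = ((2 * m + 1 : ℕ) : ℂ) := by
      rw [← hnorm]
      split_ifs
      · simp
      · simp only [map_mul, Complex.conj_I, Complex.conj_ofReal]
        linear_combination (c * c : ℂ) * Complex.I_mul_I
    rw [sq]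
    exact_mod_cast this
  have hmod : (2 * m + 1) % 4 = 1 ↔ Even m := by
    rw [Nat.even_iff]
    omega
  have hsqrt : Real.sqrt (2 * m + 1 : ℕ) = c := by rw [← hcsq, Real.sqrt_sq hc.le]
  rw [hsqrt]
  simp only [hmod]
  convert h

end

/-- **Evaluation of the quadratic Gauss sum.** For `N` an odd positive integer and
integers `a`, `b` with `gcd(a, N) = 1`,
`Σ_{n=0}^{N−1} e^{(2πi/N)(a n² + b n)} = ε_N √N J(a,N) e^{−(2πi/N)(4a)⁻¹_N b²}`,
where `ε_N = 1` if `N ≡ 1 (mod 4)`, `ε_N = i` if `N ≡ 3 (mod 4)`, `J(a,N)` is the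
Jacobi symbol, and `v` is any multiplicative inverse of `4a` modulo `N`. -/
theorem quadratic_gauss_sum_eval (N : ℕ) (hN : 0 < N) (hNodd : Odd N)
    (a b : ℤ) (ha : IsCoprime a (N : ℤ))
    (v : ℤ) (hv : 4 * a * v ≡ 1 [ZMOD (N : ℤ)]) :
    ∑ n ∈ Finset.range N,
        Complex.exp (2 * Real.pi * Complex.I *
          ((a * (n : ℤ) ^ 2 + b * (n : ℤ) : ℤ) : ℂ) / (N : ℂ)) =
      (if N % 4 = 1 then 1 else Complex.I) * (Real.sqrt N : ℂ) * (jacobiSym a N : ℂ) *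
        Complex.exp (-(2 * Real.pi * Complex.I * ((v * b ^ 2 : ℤ) : ℂ)) / (N : ℂ)) := by
  have : NeZero N := ⟨hN.ne'⟩
  have hv' : (4 * a * v : ZMod N) = 1 := by
    have := (ZMod.intCast_eq_intCast_iff _ _ N).2 hv
    simpa using this
  have hexp : Complex.exp (-(2 * Real.pi * Complex.I * ((v * b ^ 2 : ℤ) : ℂ)) / (N : ℂ)) =
      ZMod.stdAddChar ((-(v * b ^ 2) : ℤ) : ZMod N) := by
    rw [ZMod.stdAddChar_coe]
    congr 1
    push_cast
    ring
  simp_rw [← ZMod.stdAddChar_coe]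
  rw [hexp]
  calc
    _ = ∑ x : ZMod N, ZMod.stdAddChar
        ((a : ZMod N) * (x + 2 * (v : ZMod N) * (b : ZMod N)) ^ 2 +
          ((-(v * b ^ 2) : ℤ) : ZMod N)) := by
      rw [← ZMod.sum_range_natCast]
      refine Finset.sum_congr rfl fun n _ ↦ ?_
      congr 1
      push_cast
      linear_combination (-(b * n) - v * b ^ 2 : ZMod N) * hv'
    _ = quadGaussSum a N * ZMod.stdAddChar ((-(v * b ^ 2) : ℤ) : ZMod N) := by
      simp_rw [AddChar.map_add_eq_mul, ← Finset.sum_mul]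
      congr 1
      exact Fintype.sum_equiv (Equiv.addRight (2 * v * b : ZMod N)) _ _ fun _ ↦ rfl
    _ = _ := by
      rw [quadGaussSum_eq_jacobiSym_mul N hNodd a ha, quadGaussSum_one hNodd]
      ring
end
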